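/- Let d ≥ 2, let ε > 0, and let Σ be a d×d real symmetric matrix with an orthonormal basis of eigenvectors v_1, …, v_d and corresponding real eigenvalues λ_1, …, λ_d. Let b_1, …, b_d denote the standard basis vectors of ℝ^d, and suppose that for every i, ⟨v_i, b_i⟩² ≥ 1 − ε (each eigenvector is a small perturbation of the corresponding coordinate axis). Then for every i: |λ_i − Σ_{ii}| ≤ ε · max_{j ≠ i} |λ_i − λ_j|. -/

import Mathlib

open Finset Matrix

section OrthonormalEigenbasis

variable {n : Type*} [Fintype n] [DecidableEq n]

/-- Rows that are orthonormal form a matrix with orthonormal columns. -/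
theorem Matrix.transpose_of_mul_of_eq_one {v : n → n → ℝ}
    (hortho : ∀ j k, v j ⬝ᵥ v k = if j = k then (1 : ℝ) else 0) :
    (Matrix.of v)ᵀ * Matrix.of v = 1 := by
  rw [mul_eq_one_comm]
  ext j k
  rw [Matrix.one_apply, ← hortho j k]
  rfl

/-- In an orthonormal basis, the squared `i`-th coordinates sum to one. -/
theorem sum_sq_apply_eq_one_of_orthonormal {v : n → n → ℝ}
    (hortho : ∀ j k, v j ⬝ᵥ v k = if j = k then (1 : ℝ) else 0) (i : n) :
    ∑ j, v j i ^ 2 = 1 := by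
  have h := congrFun (congrFun (Matrix.transpose_of_mul_of_eq_one hortho) i) i
  simpa [Matrix.mul_apply, ← sq] using h

/-- Diagonal entries of a matrix with an orthonormal eigenbasis. -/
theorem Matrix.diag_eq_sum_eigenvalue_mul_sq {M : Matrix n n ℝ} {v : n → n → ℝ} {lam : n → ℝ}
    (hortho : ∀ j k, v j ⬝ᵥ v k = if j = k then (1 : ℝ) else 0)
    (heig : ∀ j, M.mulVec (v j) = lam j • v j) (i : n) :
    M i i = ∑ j, lam j * v j i ^ 2 := by
  have hMV : M * (Matrix.of v)ᵀ = Matrix.of fun k j => lam j * v j k := by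
    ext k j
    exact congrFun (heig j) k
  have hM : M = (Matrix.of fun k j => lam j * v j k) * Matrix.of v := by
    rw [← hMV, Matrix.mul_assoc, Matrix.transpose_of_mul_of_eq_one hortho, Matrix.mul_one]
  have h := congrFun (congrFun hM i) i
  simpa [Matrix.mul_apply, mul_assoc, ← sq] using h

end OrthonormalEigenbasis

/-- **Lemma A.3** (correlation between dimension-wise variances and covariance
eigenvalues): if `M` is symmetric with an orthonormal eigenbasis `v` and eigenvalues
`lam`, and each eigenvector is an `ε`-perturbation of the corresponding coordinate axis
(`⟨v i, b i⟩² ≥ 1 − ε`), then `|lam i − M i i| ≤ ε · max_{j ≠ i} |lam i − lam j|`. -/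
theorem diagonal_entry_eigenvalue_perturbation_bound (d : ℕ) (hd : 2 ≤ d)
    (ε : ℝ) (hε : 0 < ε)
    (M : Matrix (Fin d) (Fin d) ℝ) (hM : M.IsSymm)
    (v : Fin d → Fin d → ℝ) (lam : Fin d → ℝ)
    (hortho : ∀ j k : Fin d, v j ⬝ᵥ v k = if j = k then (1 : ℝ) else 0)
    (heig : ∀ j : Fin d, M.mulVec (v j) = lam j • v j)
    (halign : ∀ i : Fin d, 1 - ε ≤ (v i ⬝ᵥ Pi.single i (1 : ℝ)) ^ 2) :
    ∀ i : Fin d, |lam i - M i i| ≤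
      ε * ((Finset.univ.erase i).sup'
          (by
            rw [← Finset.card_pos, Finset.card_erase_of_mem (Finset.mem_univ i),
              Finset.card_univ, Fintype.card_fin]
            omega)
          fun j => |lam i - lam j|) := by
  intro i
  set s := (Finset.univ.erase i).sup' _ fun j => |lam i - lam j| with hs
  have hle : ∀ j ∈ Finset.univ.erase i, |lam i - lam j| ≤ s := fun j hj =>
    Finset.le_sup' (fun j => |lam i - lam j|) hj
  have hs0 : 0 ≤ s := by
    have : Nontrivial (Fin d) := Fin.nontrivial_iff_two_le.mpr hd
    obtain ⟨j, hj⟩ := exists_ne i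
    exact (abs_nonneg _).trans (hle j (Finset.mem_erase.mpr ⟨hj, Finset.mem_univ j⟩))
  have hsum := sum_sq_apply_eq_one_of_orthonormal hortho i
  have hoff : ∑ j ∈ Finset.univ.erase i, v j i ^ 2 ≤ ε := by
    have hi := halign i
    rw [dotProduct_single, mul_one] at hi
    rw [← Finset.add_sum_erase _ _ (Finset.mem_univ i)] at hsum
    linarith
  have hdiff : lam i - M i i = ∑ j ∈ Finset.univ.erase i, (lam i - lam j) * v j i ^ 2 := by
    have h : lam i - M i i = ∑ j, (lam i - lam j) * v j i ^ 2 := by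
      simp_rw [sub_mul, Finset.sum_sub_distrib, ← Finset.mul_sum, hsum, mul_one,
        Matrix.diag_eq_sum_eigenvalue_mul_sq hortho heig i]
    rw [h, ← Finset.add_sum_erase _ _ (Finset.mem_univ i), sub_self, zero_mul, zero_add]
  calc |lam i - M i i|
      ≤ ∑ j ∈ Finset.univ.erase i, |(lam i - lam j) * v j i ^ 2| := by
        rw [hdiff]
        exact Finset.abs_sum_le_sum_abs _ _
    _ ≤ ∑ j ∈ Finset.univ.erase i, s * v j i ^ 2 := by
        refine Finset.sum_le_sum fun j hj => ?_
        rw [abs_mul, abs_of_nonneg (sq_nonneg (v j i))]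
        exact mul_le_mul_of_nonneg_right (hle j hj) (sq_nonneg _)
    _ = (∑ j ∈ Finset.univ.erase i, v j i ^ 2) * s := by rw [← Finset.mul_sum, mul_comm]
    _ ≤ ε * s := mul_le_mul_of_nonneg_right hoff hs0
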